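/- arXiv:2507.15215 — 4 statements merged into one kernel-verified Lean document; each statement's English description precedes it below -/
import Mathlib

section
/- Under the general setting with Assumption 1, the function G(x,z) := max_{θ∈Θ} { R(x,θ) − ℓ⁻¹(I_θ(z) − r) } is real-valued (finite) for every (x,z) ∈ X × Z, the maximum over θ is attained (the map θ ↦ R(x,θ) − ℓ⁻¹(I_θ(z) − r) attains its supremum on the compact set Θ), and G : X × Z → ℝ is continuous. -/
open Filter Topology Set
open scoped ENNReal Classical

noncomputable section

/-- The regret `R(x,θ) := c(x,θ) − min_{y∈X} c(y,θ)`. -/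
def regretFn {E Θ : Type*} (c : E → Θ → ℝ) (X : Set E) (x : E) (θ : Θ) : ℝ :=
  c x θ - sInf ((fun y => c y θ) '' X)

/-- The inner expression `R(x,θ) − ℓ⁻¹(I_θ(z) − r)` as an extended real number,
with the convention that it equals `−∞` whenever `I_θ(z) = ∞`. -/
def innerFn {E Θ Z : Type*} (c : E → Θ → ℝ) (X : Set E) (linv : ℝ → ℝ) (r : ℝ)
    (I : Θ → Z → ℝ≥0∞) (x : E) (θ : Θ) (z : Z) : EReal :=
  if I θ z = ∞ then ⊥
  else ((regretFn c X x θ - linv ((I θ z).toReal - r) : ℝ) : EReal)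

/-- `G(x,z) := max_{θ∈Θ} { R(x,θ) − ℓ⁻¹(I_θ(z) − r) }` as a real number. -/
def Gfn {E Θ Z : Type*} (c : E → Θ → ℝ) (X : Set E) (linv : ℝ → ℝ) (r : ℝ)
    (I : Θ → Z → ℝ≥0∞) (x : E) (z : Z) : ℝ :=
  (⨆ θ : Θ, innerFn c X linv r I x θ z).toReal

/-- The extended-real penalty `a ↦ −ℓ⁻¹(a − r)`, equal to `−∞` at `a = ∞`. -/
def penaltyFn (linv : ℝ → ℝ) (r : ℝ) (a : ℝ≥0∞) : EReal :=
  if a = ∞ then ⊥ else ((-linv (a.toReal - r) : ℝ) : EReal)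

lemma penaltyFn_ne_top (linv : ℝ → ℝ) (r : ℝ) (a : ℝ≥0∞) : penaltyFn linv r a ≠ ⊤ := by
  unfold penaltyFn
  split_ifs
  · exact bot_ne_top
  · exact EReal.coe_ne_top _

lemma antitone_penaltyFn {linv : ℝ → ℝ} (h : Monotone linv) (r : ℝ) :
    Antitone (penaltyFn linv r) := by
  intro a b hab
  unfold penaltyFn
  by_cases hb : b = ∞
  · simp [hb]
  · have ha : a ≠ ∞ := ne_top_of_le_ne_top hb hab
    rw [if_neg hb, if_neg ha, EReal.coe_le_coe_iff]
    exact neg_le_neg (h (sub_le_sub_right (ENNReal.toReal_mono hb hab) r))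

lemma continuous_penaltyFn (e : ℝ ≃o ℝ) (r : ℝ) : Continuous (penaltyFn e r) := by
  rw [continuous_iff_continuousAt]
  intro a
  by_cases ha : a = ∞
  · subst ha
    have h : penaltyFn e r ∞ = ⊥ := if_pos rfl
    rw [ContinuousAt, h, EReal.tendsto_nhds_bot_iff_real]
    intro x
    have hlt : ENNReal.ofReal (e.symm (-x) + r) < ∞ := ENNReal.ofReal_lt_top
    filter_upwards [lt_mem_nhds hlt] with b hb
    unfold penaltyFn
    split_ifs with hb'
    · exact EReal.bot_lt_coe x
    · rw [← ENNReal.ofReal_toReal hb'] at hb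
      have hb_real := (ENNReal.ofReal_lt_ofReal_iff'.1 hb).1
      rw [EReal.coe_lt_coe_iff, neg_lt, ← e.symm_apply_lt]
      linarith
  · have hcont : ContinuousAt (fun b : ℝ≥0∞ => ((-e (b.toReal - r) : ℝ) : EReal)) a :=
      continuous_coe_real_ereal.continuousAt.comp
        (e.continuous.continuousAt.comp
          ((ENNReal.tendsto_toReal ha).sub tendsto_const_nhds)).neg
    refine hcont.congr ?_
    filter_upwards [isOpen_ne.mem_nhds ha] with b hb
    exact (if_neg hb).symm

lemma innerFn_eq_add {E Θ Z : Type*} (c : E → Θ → ℝ) (X : Set E) (linv : ℝ → ℝ) (r : ℝ)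
    (I : Θ → Z → ℝ≥0∞) (x : E) (θ : Θ) (z : Z) :
    innerFn c X linv r I x θ z = (regretFn c X x θ : EReal) + penaltyFn linv r (I θ z) := by
  unfold innerFn penaltyFn
  split_ifs
  · exact (EReal.add_bot _).symm
  · rw [← EReal.coe_add, sub_eq_add_neg]

/-- The regret is jointly continuous on `X × Θ`. -/
lemma continuous_regretFn {E Θ : Type*} [TopologicalSpace E] [TopologicalSpace Θ]
    {X : Set E} (hX : IsCompact X) {c : E → Θ → ℝ}
    (hc : ContinuousOn (fun p : E × Θ => c p.1 p.2) (X ×ˢ univ)) :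
    Continuous fun p : X × Θ => regretFn c X p.1 p.2 := by
  have : CompactSpace X := isCompact_iff_compactSpace.1 hX
  have hcX : Continuous fun p : X × Θ => c p.1 p.2 :=
    hc.comp_continuous (f := fun p : X × Θ => ((p.1 : E), p.2)) (by fun_prop)
      fun p => ⟨p.1.2, mem_univ _⟩
  have himg : ∀ θ, (fun y => c y θ) '' X = (fun y : X => c y θ) '' univ := fun θ => by
    ext t
    simp
  unfold regretFn
  simp only [himg]
  refine hcX.sub (Continuous.comp (g := fun θ => sInf ((fun y : X => c y θ) '' univ)) ?_
    continuous_snd)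
  exact isCompact_univ.continuous_sInf (f := fun θ (y : X) => c y θ) (hcX.comp continuous_swap)

section ParametricSup

variable {Y Θ α : Type*} [TopologicalSpace Y] [TopologicalSpace Θ] [CompactSpace Θ] [Nonempty Θ]
  [CompleteLinearOrder α] {φ : Y × Θ → α}

lemma UpperSemicontinuous.exists_eq_iSup_of_compactSpace (hφ : UpperSemicontinuous φ) (y : Y) :
    ∃ θ₀, φ (y, θ₀) = ⨆ θ, φ (y, θ) := by
  have h : UpperSemicontinuous fun θ => φ (y, θ) := hφ.comp (Continuous.prodMk_right y)
  obtain ⟨θ₀, -, hmax⟩ := (h.upperSemicontinuousOn univ).exists_isMaxOn univ_nonempty isCompact_univ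
  exact ⟨θ₀, le_antisymm (le_iSup (fun θ => φ (y, θ)) θ₀) (iSup_le fun θ => hmax (mem_univ θ))⟩

lemma UpperSemicontinuous.iSup_of_compactSpace (hφ : UpperSemicontinuous φ) :
    UpperSemicontinuous fun y => ⨆ θ, φ (y, θ) := by
  intro y a ha
  have h : ∀ᶠ y' in 𝓝 y, ∀ θ ∈ (univ : Set Θ), φ (y', θ) < a :=
    isCompact_univ.eventually_forall_of_forall_eventually (P := fun y' θ => φ (y', θ) < a)
      fun θ _ => hφ (y, θ) a ((le_iSup (fun θ => φ (y, θ)) θ).trans_lt ha)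
  filter_upwards [h] with y' hy'
  obtain ⟨θ₀, hθ₀⟩ := hφ.exists_eq_iSup_of_compactSpace y'
  exact hθ₀ ▸ hy' θ₀ (mem_univ _)

end ParametricSup

/-- A supremum over parameters is lower semicontinuous as soon as every value above `⊥` is a limit
of values along each convergent sequence. -/
lemma lowerSemicontinuous_iSup_of_seq {Y Θ α : Type*} [TopologicalSpace Y]
    [FirstCountableTopology Y] [CompleteLinearOrder α] [TopologicalSpace α] [OrderTopology α]
    {φ : Y × Θ → α}
    (h : ∀ y θ, φ (y, θ) ≠ ⊥ → ∀ ys : ℕ → Y, Tendsto ys atTop (𝓝 y) →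
      ∃ θs : ℕ → Θ, Tendsto (fun n => φ (ys n, θs n)) atTop (𝓝 (φ (y, θ)))) :
    LowerSemicontinuous fun y => ⨆ θ, φ (y, θ) := by
  intro y a ha
  obtain ⟨θ, hθ⟩ := lt_iSup_iff.1 ha
  rw [eventually_iff_seq_eventually]
  intro ys hys
  obtain ⟨θs, hθs⟩ := h y θ (ne_bot_of_gt hθ) ys hys
  filter_upwards [hθs.eventually_const_lt hθ] with n hn
  exact hn.trans_le (le_iSup (fun θ => φ (ys n, θ)) (θs n))

/-- under Assumption 1, for every `(x,z) ∈ X × Z` the supremum over `θ ∈ Θ`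
defining `G(x,z)` is finite and attained, and `G` is continuous on `X × Z`. -/
theorem G_finite_attained_continuous
    {E Θ Z : Type*} [NormedAddCommGroup E] [NormedSpace ℝ E]
    [MetricSpace Θ] [CompactSpace Θ] [Nonempty Θ]
    [MetricSpace Z] [Nonempty Z]
    (X : Set E) (hXcomp : IsCompact X) (hXconv : Convex ℝ X) (hXne : X.Nonempty)
    (c : E → Θ → ℝ)
    (hc : ContinuousOn (fun p : E × Θ => c p.1 p.2) (X ×ˢ univ))
    (hcconv : ∀ θ : Θ, StrictConvexOn ℝ X fun x => c x θ)
    (ℓ : ℝ → ℝ) (hℓcont : Continuous ℓ) (hℓmono : StrictMono ℓ)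
    (hℓbij : Function.Bijective ℓ) (hℓ0 : ℓ 0 = 0)
    (linv : ℝ → ℝ) (hlinv : ∀ y, ℓ (linv y) = y) (hlinv' : ∀ y, linv (ℓ y) = y)
    (r : ℝ) (hr : 0 < r)
    (I : Θ → Z → ℝ≥0∞)
    (hI1 : ∀ z : Z, ∃ θ : Θ, I θ z ≠ ∞)
    (hI2 : LowerSemicontinuous fun p : Θ × Z => I p.1 p.2)
    (hI3 : ∀ (θ : Θ) (z : Z), I θ z ≠ ∞ → ∀ zs : ℕ → Z, Tendsto zs atTop (𝓝 z) →
      ∃ θs : ℕ → Θ, Tendsto θs atTop (𝓝 θ) ∧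
        Tendsto (fun n => I (θs n) (zs n)) atTop (𝓝 (I θ z))) :
    (∀ x ∈ X, ∀ z : Z,
      -- the supremum over `θ` is attained
      (∃ θ₀ : Θ, innerFn c X linv r I x θ₀ z = ⨆ θ : Θ, innerFn c X linv r I x θ z) ∧
      -- the supremum is a (finite) real number, equal to `G(x,z)`
      (⨆ θ : Θ, innerFn c X linv r I x θ z) = ((Gfn c X linv r I x z : ℝ) : EReal)) ∧
    -- `G` is continuous on `X × Z`
    ContinuousOn (fun p : E × Z => Gfn c X linv r I p.1 p.2) (X ×ˢ univ) := by
  let e : ℝ ≃o ℝ := (hℓmono.orderIsoOfRightInverse ℓ linv hlinv).symm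
  have hpc : Continuous (penaltyFn linv r) := continuous_penaltyFn e r
  have hR := continuous_coe_real_ereal.comp (continuous_regretFn hXcomp hc)
  let φ : (X × Z) × Θ → EReal := fun p => innerFn c X linv r I p.1.1 p.2 p.1.2
  have hφ_eq : ∀ p, φ p =
      (regretFn c X p.1.1 p.2 : EReal) + penaltyFn linv r (I p.2 p.1.2) := fun p =>
    innerFn_eq_add ..
  have hadd : ∀ (a : ℝ) (b : EReal),
      ContinuousAt (fun p : EReal × EReal => p.1 + p.2) ((a : EReal), b) := fun a b =>
    EReal.continuousAt_add (Or.inl (EReal.coe_ne_top a)) (Or.inl (EReal.coe_ne_bot a))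
  have hφ : UpperSemicontinuous φ := by
    have h1 : UpperSemicontinuous fun p : (X × Z) × Θ => (regretFn c X p.1.1 p.2 : EReal) :=
      (hR.comp (g := _) (f := fun p : (X × Z) × Θ => (p.1.1, p.2))
        (by fun_prop)).upperSemicontinuous
    have h2 : UpperSemicontinuous fun p : (X × Z) × Θ => penaltyFn linv r (I p.2 p.1.2) :=
      (hpc.comp_lowerSemicontinuous_antitone hI2 (antitone_penaltyFn e.monotone r)).comp
        (g := fun p : (X × Z) × Θ => (p.2, p.1.2)) (by fun_prop)
    rw [funext hφ_eq]
    exact h1.add' h2 fun p => hadd _ _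
  have hlsc : LowerSemicontinuous fun y => ⨆ θ, φ (y, θ) := by
    refine lowerSemicontinuous_iSup_of_seq fun y θ hne ys hys => ?_
    have hfin : I θ y.2 ≠ ∞ := fun h => hne (if_pos h)
    obtain ⟨θs, hθs, hIs⟩ := hI3 θ y.2 hfin (fun n => (ys n).2) ((continuous_snd.tendsto y).comp hys)
    refine ⟨θs, ?_⟩
    simp only [hφ_eq]
    have h1 : Tendsto (fun n => (regretFn c X (ys n).1 (θs n) : EReal)) atTop
        (𝓝 (regretFn c X y.1 θ : EReal)) :=
      (hR.tendsto (y.1, θ)).comp (((continuous_fst.tendsto y).comp hys).prodMk_nhds hθs)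
    exact (hadd _ _).tendsto.comp (h1.prodMk_nhds ((hpc.tendsto _).comp hIs))
  have hcont : Continuous fun y => ⨆ θ, φ (y, θ) :=
    continuous_iff_lower_upperSemicontinuous.2 ⟨hlsc, hφ.iSup_of_compactSpace⟩
  have hbot : ∀ y, (⨆ θ, φ (y, θ)) ≠ ⊥ := by
    intro y
    obtain ⟨θ, hθ⟩ := hI1 y.2
    refine ne_bot_of_le_ne_bot ?_ (le_iSup (fun θ => φ (y, θ)) θ)
    have h : φ (y, θ) = _ := if_neg hθ
    rw [h]
    exact EReal.coe_ne_bot _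
  have htop : ∀ y, (⨆ θ, φ (y, θ)) ≠ ⊤ := by
    intro y
    obtain ⟨θ₀, hθ₀⟩ := hφ.exists_eq_iSup_of_compactSpace y
    rw [← hθ₀, hφ_eq]
    exact EReal.add_ne_top (EReal.coe_ne_top _) (penaltyFn_ne_top _ _ _)
  refine ⟨fun x hx z => ⟨hφ.exists_eq_iSup_of_compactSpace (⟨x, hx⟩, z), ?_⟩, ?_⟩
  · exact (EReal.coe_toReal (htop (⟨x, hx⟩, z)) (hbot (⟨x, hx⟩, z))).symm
  · have hG : Continuous fun y : X × Z => (⨆ θ, φ (y, θ)).toReal :=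
      continuous_iff_continuousAt.2 fun y =>
        (EReal.tendsto_toReal (htop y) (hbot y)).comp (hcont.tendsto y)
    rw [continuousOn_iff_continuous_domRestrict]
    exact hG.comp (f := fun p : (X ×ˢ univ : Set (E × Z)) => ((⟨p.1.1, p.2.1⟩ : X), p.1.2))
      (by fun_prop)

end
end

section
/- (Feasibility, out-of-sample-cost version.) Under the general setting with Assumption 1, define G_c(x,z) := max_{θ∈Θ} { c(x,θ) − ℓ⁻¹(I_θ(z) − r) }, u_c*(z) := min_{x∈X} G_c(x,z) and X_c*(z) := argmin_{x∈X} G_c(x,z). Then X_c* : Z → X and u_c* : Z → ℝ are continuous, and for every θ ∈ Θ, sup_{z∈Z} { ℓ( c(X_c*(z), θ) − u_c*(z) ) − I_θ(z) } ≤ −r, with the convention that the expression inside the supremum equals −∞ when I_θ(z) = ∞. -/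
open Filter Topology Set
open scoped ENNReal Classical

noncomputable section

/-- The inner expression `c(x,θ) − ℓ⁻¹(I_θ(z) − r)` as an extended real number,
with the convention that it equals `−∞` whenever `I_θ(z) = ∞`. -/
def innerC {E Θ Z : Type*} (c : E → Θ → ℝ) (linv : ℝ → ℝ) (r : ℝ)
    (I : Θ → Z → ℝ≥0∞) (x : E) (θ : Θ) (z : Z) : EReal :=
  if I θ z = ∞ then ⊥
  else ((c x θ - linv ((I θ z).toReal - r) : ℝ) : EReal)

/-- `G_c(x,z) := max_{θ∈Θ} { c(x,θ) − ℓ⁻¹(I_θ(z) − r) }` as a real number. -/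
def GcFn {E Θ Z : Type*} (c : E → Θ → ℝ) (linv : ℝ → ℝ) (r : ℝ)
    (I : Θ → Z → ℝ≥0∞) (x : E) (z : Z) : ℝ :=
  (⨆ θ : Θ, innerC c linv r I x θ z).toReal

/-- `u_c*(z) := min_{x∈X} G_c(x,z)`. -/
def ucstarFn {E Θ Z : Type*} (c : E → Θ → ℝ) (X : Set E) (linv : ℝ → ℝ) (r : ℝ)
    (I : Θ → Z → ℝ≥0∞) (z : Z) : ℝ :=
  sInf ((fun x => GcFn c linv r I x z) '' X)

section

variable {E Θ Z : Type*} {c : E → Θ → ℝ} {ℓ linv : ℝ → ℝ} {r : ℝ} {I : Θ → Z → ℝ≥0∞}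

lemma innerC_lt_coe_iff (hℓ : StrictMono ℓ) (hlinv : ∀ y, ℓ (linv y) = y)
    (x : E) (θ : Θ) (z : Z) (a : ℝ) :
    innerC c linv r I x θ z < (a : EReal) ↔
      ((ℓ (c x θ - a) + r : ℝ) : EReal) < (I θ z : EReal) := by
  by_cases h : I θ z = ∞
  · rw [h, EReal.coe_ennreal_top]
    simp only [innerC, h, if_true, EReal.bot_lt_coe, EReal.coe_lt_top]
  · have hI : (I θ z : EReal) = ((I θ z).toReal : ℝ) :=
      (EReal.coe_toReal (by simpa using h) (by simp)).symm.trans (by simp)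
    rw [innerC, if_neg h, hI, EReal.coe_lt_coe_iff, EReal.coe_lt_coe_iff, sub_lt_comm,
      ← hℓ.lt_iff_lt, hlinv, lt_sub_iff_add_lt]

lemma coe_lt_innerC_iff (hℓ : StrictMono ℓ) (hlinv : ∀ y, ℓ (linv y) = y)
    (x : E) (θ : Θ) (z : Z) (a : ℝ) :
    (a : EReal) < innerC c linv r I x θ z ↔
      (I θ z : EReal) < ((ℓ (c x θ - a) + r : ℝ) : EReal) := by
  by_cases h : I θ z = ∞
  · simp [innerC, h]
  · have hI : (I θ z : EReal) = ((I θ z).toReal : ℝ) :=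
      (EReal.coe_toReal (by simpa using h) (by simp)).symm.trans (by simp)
    rw [innerC, if_neg h, hI, EReal.coe_lt_coe_iff, EReal.coe_lt_coe_iff, lt_sub_comm,
      ← hℓ.lt_iff_lt, hlinv, sub_lt_iff_lt_add]

variable [TopologicalSpace E] [TopologicalSpace Θ] [CompactSpace Θ]

lemma coe_GcFn (hc : Continuous fun p : E × Θ => c p.1 p.2)
    (hℓ : StrictMono ℓ) (hlinv : ∀ y, ℓ (linv y) = y)
    (hI1 : ∀ z : Z, ∃ θ : Θ, I θ z ≠ ∞) (x : E) (z : Z) :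
    (GcFn c linv r I x z : EReal) = ⨆ θ, innerC c linv r I x θ z := by
  obtain ⟨M, hM⟩ := (isCompact_range
    (hc.comp (by fun_prop : Continuous fun θ : Θ => (x, θ)))).bddAbove
  apply EReal.coe_toReal
  · refine ne_top_of_le_ne_top (EReal.coe_ne_top (M - linv (-r) + 1)) (iSup_le fun θ => ?_)
    refine ((innerC_lt_coe_iff hℓ hlinv x θ z _).2 ?_).le
    have h₁ : c x θ ≤ M := hM ⟨θ, rfl⟩
    have h₂ : ℓ (c x θ - (M - linv (-r) + 1)) < -r := by
      conv_rhs => rw [← hlinv (-r)]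
      exact hℓ (by linarith)
    exact lt_of_lt_of_le (EReal.coe_lt_coe_iff.2 (by linarith : _ < (0 : ℝ)))
      (EReal.coe_ennreal_nonneg _)
  · obtain ⟨θ, hθ⟩ := hI1 z
    refine ne_bot_of_le_ne_bot ?_ (le_iSup _ θ)
    rw [innerC, if_neg hθ]
    exact EReal.coe_ne_bot _

variable [TopologicalSpace Z]

/-- Compactness of the parameter space makes the strict bound stable. -/
lemma eventually_forall_innerC_lt (hc : Continuous fun p : E × Θ => c p.1 p.2)
    (hℓcont : Continuous ℓ) (hℓ : StrictMono ℓ) (hlinv : ∀ y, ℓ (linv y) = y)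
    (hI : LowerSemicontinuous fun p : Θ × Z => I p.1 p.2) {a : ℝ} {x : E} {z : Z}
    (h : ∀ θ, innerC c linv r I x θ z < (a : EReal)) :
    ∀ᶠ q : ℝ × E × Z in 𝓝 (a, x, z),
      ∀ θ, innerC c linv r I q.2.1 θ q.2.2 < (q.1 : EReal) := by
  simp only [innerC_lt_coe_iff hℓ hlinv] at h ⊢
  have key := (isCompact_univ (X := Θ)).eventually_forall_of_forall_eventually
    (x₀ := (a, x, z)) (P := fun q θ =>
      ((ℓ (c q.2.1 θ - q.1) + r : ℝ) : EReal) < (I θ q.2.2 : EReal)) ?_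
  · simpa using key
  intro θ _
  obtain ⟨b, hb₁, hb₂⟩ := exists_between (h θ)
  have hcont : Continuous fun p : (ℝ × E × Z) × Θ =>
      ((ℓ (c p.1.2.1 p.2 - p.1.1) + r : ℝ) : EReal) := by
    refine continuous_coe_real_ereal.comp ((hℓcont.comp (Continuous.sub ?_ ?_)).add_const r)
    · exact hc.comp (by fun_prop : Continuous fun p : (ℝ × E × Z) × Θ => (p.1.2.1, p.2))
    · fun_prop
  have hlsc : LowerSemicontinuous fun p : (ℝ × E × Z) × Θ => (I p.2 p.1.2.2 : EReal) :=
    (continuous_coe_ennreal_ereal.comp_lowerSemicontinuous hI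
      fun _ _ h => EReal.coe_ennreal_le_coe_ennreal_iff.2 h).comp
      (by fun_prop : Continuous fun p : (ℝ × E × Z) × Θ => (p.2, p.1.2.2))
  filter_upwards [hcont.continuousAt.eventually_lt_const hb₁, hlsc ((a, x, z), θ) b hb₂]
    with p h₁ h₂ using h₁.trans h₂

/-- The supremum defining `GcFn` is attained. -/
lemma GcFn_lt_iff (hc : Continuous fun p : E × Θ => c p.1 p.2)
    (hℓcont : Continuous ℓ) (hℓ : StrictMono ℓ) (hlinv : ∀ y, ℓ (linv y) = y)
    (hI1 : ∀ z : Z, ∃ θ : Θ, I θ z ≠ ∞)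
    (hI2 : LowerSemicontinuous fun p : Θ × Z => I p.1 p.2) {a : ℝ} {x : E} {z : Z} :
    GcFn c linv r I x z < a ↔ ∀ θ, innerC c linv r I x θ z < (a : EReal) := by
  rw [← EReal.coe_lt_coe_iff, coe_GcFn hc hℓ hlinv hI1]
  refine ⟨fun h θ => (le_iSup _ θ).trans_lt h, fun h => ?_⟩
  have hev := ((by fun_prop : Continuous fun b : ℝ => (b, x, z)).tendsto a).eventually
    (eventually_forall_innerC_lt hc hℓcont hℓ hlinv hI2 h)
  obtain ⟨b, hb, hba⟩ := ((hev.filter_mono nhdsWithin_le_nhds).and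
    (self_mem_nhdsWithin (s := Iio a))).exists
  exact (iSup_le fun θ => (hb θ).le).trans_lt (EReal.coe_lt_coe_iff.2 hba)

lemma continuous_GcFn [FirstCountableTopology E] [FirstCountableTopology Z]
    (hc : Continuous fun p : E × Θ => c p.1 p.2)
    (hℓcont : Continuous ℓ) (hℓ : StrictMono ℓ) (hlinv : ∀ y, ℓ (linv y) = y)
    (hI1 : ∀ z : Z, ∃ θ : Θ, I θ z ≠ ∞)
    (hI2 : LowerSemicontinuous fun p : Θ × Z => I p.1 p.2)
    (hI3 : ∀ (θ : Θ) (z : Z), I θ z ≠ ∞ → ∀ zs : ℕ → Z, Tendsto zs atTop (𝓝 z) →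
      ∃ θs : ℕ → Θ, Tendsto θs atTop (𝓝 θ) ∧
        Tendsto (fun n => I (θs n) (zs n)) atTop (𝓝 (I θ z))) :
    Continuous fun p : E × Z => GcFn c linv r I p.1 p.2 := by
  refine continuous_iff_continuousAt.2 fun ⟨x, z⟩ =>
    tendsto_order.2 ⟨fun a ha => ?_, fun a ha => ?_⟩
  · by_contra hfreq
    obtain ⟨qs, hqs, hle⟩ := exists_seq_forall_of_frequently (not_eventually.1 hfreq)
    rw [← EReal.coe_lt_coe_iff, coe_GcFn hc hℓ hlinv hI1, lt_iSup_iff] at ha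
    obtain ⟨θ, hθ⟩ := ha
    have hfin : I θ z ≠ ∞ := fun h => by simp [innerC, h] at hθ
    obtain ⟨θs, hθs, hIs⟩ := hI3 θ z hfin _ ((continuous_snd.tendsto _).comp hqs)
    rw [coe_lt_innerC_iff hℓ hlinv] at hθ
    have h₁ : Tendsto (fun n => (I (θs n) (qs n).2 : EReal)) atTop (𝓝 (I θ z : EReal)) :=
      (continuous_coe_ennreal_ereal.tendsto _).comp hIs
    have h₂ : Tendsto (fun n => ((ℓ (c (qs n).1 (θs n) - a) + r : ℝ) : EReal)) atTop
        (𝓝 ((ℓ (c x θ - a) + r : ℝ) : EReal)) := by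
      have hcont : Continuous fun p : E × Θ => ((ℓ (c p.1 p.2 - a) + r : ℝ) : EReal) :=
        continuous_coe_real_ereal.comp ((hℓcont.comp (hc.sub continuous_const)).add_const r)
      exact (hcont.tendsto (x, θ)).comp (((continuous_fst.tendsto _).comp hqs).prodMk_nhds hθs)
    obtain ⟨n, hn⟩ := (h₁.eventually_lt h₂ hθ).exists
    refine hle n ?_
    rw [← EReal.coe_lt_coe_iff, coe_GcFn hc hℓ hlinv hI1, lt_iSup_iff]
    exact ⟨θs n, (coe_lt_innerC_iff hℓ hlinv _ _ _ _).2 hn⟩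
  · simp only [GcFn_lt_iff hc hℓcont hℓ hlinv hI1 hI2] at ha ⊢
    exact ((by fun_prop : Continuous fun p : E × Z => (a, p.1, p.2)).tendsto (x, z)).eventually
      (eventually_forall_innerC_lt hc hℓcont hℓ hlinv hI2 ha)

end

/-- A map into a compact space whose values are unique minimizers of a jointly continuous
objective is continuous. -/
lemma continuous_of_unique_minimizer {E Z : Type*} [TopologicalSpace E] [CompactSpace E]
    [TopologicalSpace Z] {G : E × Z → ℝ} (hG : Continuous G) {f : Z → E}
    (hmin : ∀ z y, G (f z, z) ≤ G (y, z))
    (huniq : ∀ z x, (∀ y, G (x, z) ≤ G (y, z)) → x = f z) : Continuous f := by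
  have hgraph : IsClosed {p : E × Z | ∀ y, G p ≤ G (y, p.2)} := by
    simp only [ofPred_forall]
    exact isClosed_iInter fun y => isClosed_le hG (hG.comp (by fun_prop))
  refine continuous_iff_isClosed.2 fun s hs => ?_
  convert isClosedMap_snd_of_compactSpace _ ((hs.preimage continuous_fst).inter hgraph) using 1
  ext z
  constructor
  · exact fun hz => ⟨(f z, z), ⟨hz, hmin z⟩, rfl⟩
  · rintro ⟨⟨x, z'⟩, ⟨hx, hx'⟩, rfl⟩
    exact huniq z' x hx' ▸ hx

/-- feasibility, out-of-sample-cost version: `X_c*` and `u_c*` are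
continuous and for every `θ ∈ Θ`,
`sup_{z∈Z} { ℓ(c(X_c*(z),θ) − u_c*(z)) − I_θ(z) } ≤ −r`, the expression inside the
supremum being `−∞` when `I_θ(z) = ∞`. -/
theorem optimal_pair_feasible_cost
    {E Θ Z : Type*} [NormedAddCommGroup E] [NormedSpace ℝ E]
    [MetricSpace Θ] [CompactSpace Θ] [Nonempty Θ]
    [MetricSpace Z] [Nonempty Z]
    (X : Set E) (hXcomp : IsCompact X) (hXconv : Convex ℝ X) (hXne : X.Nonempty)
    (c : E → Θ → ℝ)
    (hc : ContinuousOn (fun p : E × Θ => c p.1 p.2) (X ×ˢ univ))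
    (hcconv : ∀ θ : Θ, StrictConvexOn ℝ X fun x => c x θ)
    (ℓ : ℝ → ℝ) (hℓcont : Continuous ℓ) (hℓmono : StrictMono ℓ)
    (hℓbij : Function.Bijective ℓ) (hℓ0 : ℓ 0 = 0)
    (linv : ℝ → ℝ) (hlinv : ∀ y, ℓ (linv y) = y) (hlinv' : ∀ y, linv (ℓ y) = y)
    (r : ℝ) (hr : 0 < r)
    (I : Θ → Z → ℝ≥0∞)
    (hI1 : ∀ z : Z, ∃ θ : Θ, I θ z ≠ ∞)
    (hI2 : LowerSemicontinuous fun p : Θ × Z => I p.1 p.2)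
    (hI3 : ∀ (θ : Θ) (z : Z), I θ z ≠ ∞ → ∀ zs : ℕ → Z, Tendsto zs atTop (𝓝 z) →
      ∃ θs : ℕ → Θ, Tendsto θs atTop (𝓝 θ) ∧
        Tendsto (fun n => I (θs n) (zs n)) atTop (𝓝 (I θ z)))
    (Xcstar : Z → E)
    (hXcstar : ∀ z : Z, Xcstar z ∈ X ∧
      ∀ y ∈ X, GcFn c linv r I (Xcstar z) z ≤ GcFn c linv r I y z) :
    Continuous Xcstar ∧ Continuous (ucstarFn c X linv r I) ∧
    ∀ θ : Θ,
      (⨆ z : Z, if I θ z = ∞ then (⊥ : EReal)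
        else ((ℓ (c (Xcstar z) θ - ucstarFn c X linv r I z)
                - (I θ z).toReal : ℝ) : EReal))
        ≤ ((-r : ℝ) : EReal) := by
  have hcX : Continuous fun p : X × Θ => c p.1 p.2 :=
    hc.comp_continuous (by fun_prop : Continuous fun p : X × Θ => ((p.1 : E), p.2))
      fun p => ⟨p.1.2, mem_univ _⟩
  have : CompactSpace X := isCompact_iff_compactSpace.1 hXcomp
  let G : X × Z → ℝ := fun p => GcFn (fun (x : X) θ => c x θ) linv r I p.1 p.2
  have hG : Continuous G := continuous_GcFn hcX hℓcont hℓmono hlinv hI1 hI2 hI3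
  let f : Z → X := fun z => ⟨Xcstar z, (hXcstar z).1⟩
  have hmin : ∀ z y, G (f z, z) ≤ G (y, z) := fun z y => (hXcstar z).2 y y.2
  have hle : ∀ (x : X) z θ, I θ z ≠ ∞ → c x θ - linv ((I θ z).toReal - r) ≤ G (x, z) := by
    intro x z θ hθ
    have h := le_iSup (fun θ => innerC (fun (x : X) θ => c x θ) linv r I x θ z) θ
    rw [← coe_GcFn hcX hℓmono hlinv hI1] at h
    simpa only [innerC, if_neg hθ, EReal.coe_le_coe_iff] using h
  have huniq : ∀ z x, (∀ y, G (x, z) ≤ G (y, z)) → x = f z := by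
    intro z x hx
    by_contra hne
    have heq : G (x, z) = G (f z, z) := le_antisymm (hx _) (hmin z x)
    have hne' : (x : E) ≠ f z := fun h => hne (Subtype.ext h)
    let m : X := ⟨(1 / 2 : ℝ) • (x : E) + (1 / 2 : ℝ) • (f z : E),
      hXconv x.2 (f z).2 (by norm_num) (by norm_num) (by norm_num)⟩
    refine (hx m).not_gt ((GcFn_lt_iff hcX hℓcont hℓmono hlinv hI1 hI2).2 fun θ => ?_)
    by_cases hθ : I θ z = ∞
    · simp [innerC, hθ, EReal.bot_lt_coe]
    · rw [innerC, if_neg hθ, EReal.coe_lt_coe_iff]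
      have h := (hcconv θ).2 x.2 (f z).2 hne' (by norm_num : (0 : ℝ) < 1 / 2)
        (by norm_num : (0 : ℝ) < 1 / 2) (by norm_num)
      simp only [smul_eq_mul] at h
      have h₁ := hle x z θ hθ
      have h₂ := hle (f z) z θ hθ
      change c ((1 / 2 : ℝ) • (x : E) + (1 / 2 : ℝ) • (f z : E)) θ - _ < G (x, z)
      linarith
  have hf : Continuous f := continuous_of_unique_minimizer hG hmin huniq
  have hu : ∀ z, ucstarFn c X linv r I z = G (f z, z) := fun z =>
    IsLeast.csInf_eq ⟨⟨_, (hXcstar z).1, rfl⟩, forall_mem_image.2 (hXcstar z).2⟩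
  refine ⟨continuous_subtype_val.comp hf, ?_, fun θ => iSup_le fun z => ?_⟩
  · exact (hG.comp (hf.prodMk continuous_id)).congr fun z => (hu z).symm
  · split_ifs with hθ
    · exact bot_le
    · rw [EReal.coe_le_coe_iff, hu]
      have h₁ : c (Xcstar z) θ - linv ((I θ z).toReal - r) ≤ G (f z, z) := hle (f z) z θ hθ
      have h₂ : ℓ (c (Xcstar z) θ - G (f z, z)) ≤ (I θ z).toReal - r := by
        conv_rhs => rw [← hlinv ((I θ z).toReal - r)]
        exact hℓmono.monotone (by linarith)
      linarith

end
end

section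
/- (Upper bound on the consistency gap.) Under the general setting with Assumption 1, let Z_∞ : Θ → Z and define the consistency gap Γ(θ) := R(X*(Z_∞(θ)), θ). Then for every θ ∈ Θ, Γ(θ) ≤ min_{x∈X} max_{θ'∈Θ} { R(x,θ') − ℓ⁻¹(I_{θ'}(Z_∞(θ)) − r) } + ℓ⁻¹(I_θ(Z_∞(θ)) − r), provided I_θ(Z_∞(θ)) < ∞ (so that the last term is finite). -/
open Filter Topology Set
open scoped ENNReal Classical

noncomputable section

/-- `u*(z) := min_{x∈X} G(x,z)`. -/
def ustarFn {E Θ Z : Type*} (c : E → Θ → ℝ) (X : Set E) (linv : ℝ → ℝ) (r : ℝ)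
    (I : Θ → Z → ℝ≥0∞) (z : Z) : ℝ :=
  sInf ((fun x => Gfn c X linv r I x z) '' X)

/-- On a compact decision space, the regret is bounded above uniformly in the parameter. -/
theorem exists_regretFn_le {E Θ : Type*} [TopologicalSpace E] [TopologicalSpace Θ]
    [CompactSpace Θ] {X : Set E} (hX : IsCompact X) {c : E → Θ → ℝ}
    (hc : ContinuousOn (fun p : E × Θ => c p.1 p.2) (X ×ˢ univ)) {x : E} (hx : x ∈ X) :
    ∃ M : ℝ, ∀ θ : Θ, regretFn c X x θ ≤ M := by
  obtain ⟨C, hC⟩ := (hX.prod isCompact_univ).exists_bound_of_continuousOn hc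
  have hbound (y : E) (hy : y ∈ X) (θ : Θ) : |c y θ| ≤ C := hC (y, θ) ⟨hy, mem_univ θ⟩
  refine ⟨C + C, fun θ => ?_⟩
  have hinf : -C ≤ sInf ((fun y => c y θ) '' X) := by
    refine le_csInf (Set.Nonempty.image _ ⟨x, hx⟩) ?_
    rintro _ ⟨y, hy, rfl⟩
    exact (abs_le.1 (hbound y hy θ)).1
  have := (abs_le.1 (hbound x hx θ)).2
  unfold regretFn
  linarith

/-- `G(x,z)` dominates each of its finite terms when the regret is bounded above. -/
theorem regretFn_sub_le_Gfn {E Θ Z : Type*} {c : E → Θ → ℝ} {X : Set E} {linv : ℝ → ℝ}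
    (hlinv : Monotone linv) (r : ℝ) {I : Θ → Z → ℝ≥0∞} {x : E} {M : ℝ}
    (hM : ∀ θ, regretFn c X x θ ≤ M) {θ : Θ} {z : Z} (hθ : I θ z ≠ ∞) :
    regretFn c X x θ - linv ((I θ z).toReal - r) ≤ Gfn c X linv r I x z := by
  have hle : (⨆ θ' : Θ, innerFn c X linv r I x θ' z) ≤ ((M - linv (-r) : ℝ) : EReal) := by
    refine iSup_le fun θ' => ?_
    unfold innerFn
    split_ifs
    · exact bot_le
    · have : linv (-r) ≤ linv ((I θ' z).toReal - r) :=
        hlinv (by linarith [ENNReal.toReal_nonneg (a := I θ' z)])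
      exact EReal.coe_le_coe_iff.2 (by linarith [hM θ'])
  have hterm : ((regretFn c X x θ - linv ((I θ z).toReal - r) : ℝ) : EReal) ≤
      ⨆ θ' : Θ, innerFn c X linv r I x θ' z := by
    refine le_iSup_of_le θ ?_
    rw [innerFn, if_neg hθ]
  have := EReal.toReal_le_toReal hterm (EReal.coe_ne_bot _)
    (hle.trans_lt (EReal.coe_lt_top _)).ne
  rwa [EReal.toReal_coe] at this

/-- upper bound on the consistency gap: with `Γ(θ) := R(X*(Z_∞(θ)),θ)`,
for every `θ ∈ Θ` with `I_θ(Z_∞(θ)) < ∞`,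
`Γ(θ) ≤ min_{x∈X} max_{θ'∈Θ} { R(x,θ') − ℓ⁻¹(I_{θ'}(Z_∞(θ)) − r) } + ℓ⁻¹(I_θ(Z_∞(θ)) − r)`. -/
theorem consistency_gap_upper_bound
    {E Θ Z : Type*} [NormedAddCommGroup E] [NormedSpace ℝ E]
    [MetricSpace Θ] [CompactSpace Θ] [Nonempty Θ]
    [MetricSpace Z] [Nonempty Z]
    (X : Set E) (hXcomp : IsCompact X) (hXconv : Convex ℝ X) (hXne : X.Nonempty)
    (c : E → Θ → ℝ)
    (hc : ContinuousOn (fun p : E × Θ => c p.1 p.2) (X ×ˢ univ))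
    (hcconv : ∀ θ : Θ, StrictConvexOn ℝ X fun x => c x θ)
    (ℓ : ℝ → ℝ) (hℓcont : Continuous ℓ) (hℓmono : StrictMono ℓ)
    (hℓbij : Function.Bijective ℓ) (hℓ0 : ℓ 0 = 0)
    (linv : ℝ → ℝ) (hlinv : ∀ y, ℓ (linv y) = y) (hlinv' : ∀ y, linv (ℓ y) = y)
    (r : ℝ) (hr : 0 < r)
    (I : Θ → Z → ℝ≥0∞)
    (hI1 : ∀ z : Z, ∃ θ : Θ, I θ z ≠ ∞)
    (hI2 : LowerSemicontinuous fun p : Θ × Z => I p.1 p.2)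
    (hI3 : ∀ (θ : Θ) (z : Z), I θ z ≠ ∞ → ∀ zs : ℕ → Z, Tendsto zs atTop (𝓝 z) →
      ∃ θs : ℕ → Θ, Tendsto θs atTop (𝓝 θ) ∧
        Tendsto (fun n => I (θs n) (zs n)) atTop (𝓝 (I θ z)))
    (Xstar : Z → E)
    (hXstar : ∀ z : Z, Xstar z ∈ X ∧
      ∀ y ∈ X, Gfn c X linv r I (Xstar z) z ≤ Gfn c X linv r I y z)
    (Zinf : Θ → Z) :
    ∀ θ : Θ, I θ (Zinf θ) ≠ ∞ →
      regretFn c X (Xstar (Zinf θ)) θ ≤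
        ustarFn c X linv r I (Zinf θ) + linv ((I θ (Zinf θ)).toReal - r) := by
  intro θ hθ
  have hlinv_mono : Monotone linv := fun a b hab =>
    hℓmono.le_iff_le.1 (by rwa [hlinv, hlinv])
  obtain ⟨hmem, hmin⟩ := hXstar (Zinf θ)
  obtain ⟨M, hM⟩ := exists_regretFn_le hXcomp hc hmem
  have hG := regretFn_sub_le_Gfn hlinv_mono r hM hθ
  have hu : Gfn c X linv r I (Xstar (Zinf θ)) (Zinf θ) ≤ ustarFn c X linv r I (Zinf θ) := by
    refine le_csInf (hXne.image _) ?_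
    rintro _ ⟨y, hy, rfl⟩
    exact hmin y hy
  linarith

end
end

section
/- The relative entropy I^ENT on the probability simplex satisfies the approximation property (III) of Assumption 1: for every pair (θ, z) ∈ Δ_d × Δ_d with I^ENT_θ(z) < ∞ (i.e. θ_i = 0 ⇒ z_i = 0 for all i) and every sequence (z_n) ⊆ Δ_d with z_n → z, there exists a sequence (θ_n) ⊆ Δ_d with θ_n → θ and I^ENT_{θ_n}(z_n) → I^ENT_θ(z) as n → ∞. -/
open Filter Topology Set Real
open scoped ENNReal Classical BigOperators

noncomputable section

/-- The relative entropy `I^ENT_θ(z) = Σ_i z_i log(z_i/θ_i)` on `ℝ^d`, valued in `[0,∞]`,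
equal to `∞` unless `θ_i = 0 ⇒ z_i = 0` for all `i`.  (In Mathlib, `Real.log 0 = 0` and
`x / 0 = 0`, so the conventions `0·log 0 = 0` and `0·log(0/0) = 0` hold automatically.) -/
def relEnt (d : ℕ) (θ z : Fin d → ℝ) : ℝ≥0∞ :=
  if ∀ i, θ i = 0 → z i = 0 then
    ENNReal.ofReal (∑ i, z i * Real.log (z i / θ i))
  else ∞

/-- The map `(x, t) ↦ x * log (x / t)` is sequentially continuous wherever the limit of `t` is
nonzero, including at `x = 0`. -/
theorem tendsto_mul_log_div {α : Type*} {l : Filter α} {f g : α → ℝ} {x t : ℝ}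
    (hf : Tendsto f l (𝓝 x)) (hg : Tendsto g l (𝓝 t)) (ht : t ≠ 0) :
    Tendsto (fun a => f a * Real.log (f a / g a)) l (𝓝 (x * Real.log (x / t))) := by
  have h := hg.mul ((Real.continuous_mul_log.tendsto (x / t)).comp (hf.div hg ht))
  rw [← mul_assoc, mul_div_cancel₀ x ht] at h
  refine h.congr' ?_
  filter_upwards [hg.eventually_ne ht] with a ha
  simp only [Function.comp_apply, Pi.div_apply]
  rw [← mul_assoc, mul_div_cancel₀ _ ha]

/-- the relative entropy on the probability simplex satisfies the
approximation property (III) of Assumption 1: whenever `I^ENT_θ(z) < ∞` and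
`z_n → z` in `Δ_d`, there exist `θ_n → θ` in `Δ_d` with `I^ENT_{θ_n}(z_n) → I^ENT_θ(z)`. -/
theorem relEnt_approximation_property (d : ℕ) (θ z : Fin d → ℝ)
    (hθ : θ ∈ stdSimplex ℝ (Fin d)) (hz : z ∈ stdSimplex ℝ (Fin d))
    (hfin : relEnt d θ z ≠ ∞)
    (zs : ℕ → Fin d → ℝ) (hzs : ∀ n, zs n ∈ stdSimplex ℝ (Fin d))
    (hzconv : Tendsto zs atTop (𝓝 z)) :
    ∃ θs : ℕ → Fin d → ℝ, (∀ n, θs n ∈ stdSimplex ℝ (Fin d)) ∧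
      Tendsto θs atTop (𝓝 θ) ∧
      Tendsto (fun n => relEnt d (θs n) (zs n)) atTop (𝓝 (relEnt d θ z)) := by
  have hac : ∀ i, θ i = 0 → z i = 0 := by
    by_contra h
    exact hfin (if_neg h)
  have hz_i : ∀ i, Tendsto (fun n => zs n i) atTop (𝓝 (z i)) := tendsto_pi_nhds.1 hzconv
  have hshift : Tendsto (fun n => θ + zs n - z) atTop (𝓝 θ) := by
    simpa using (hzconv.const_add θ).sub_const z
  have hpos : ∀ᶠ n in atTop, ∀ i, θ i ≠ 0 → 0 < (θ + zs n - z) i := by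
    refine eventually_all.2 fun i => ?_
    by_cases hi : θ i = 0
    · simp [hi]
    · filter_upwards [(tendsto_pi_nhds.1 hshift i).eventually_const_lt
        ((hθ.1 i).lt_of_ne' hi)] with n hn _ using hn
  have hzero : ∀ n i, θ i = 0 → (θ + zs n - z) i = zs n i := fun n i hi => by
    simp [hi, hac i hi]
  have hmem : ∀ᶠ n in atTop, θ + zs n - z ∈ stdSimplex ℝ (Fin d) := by
    filter_upwards [hpos] with n hn
    refine ⟨fun i => ?_, ?_⟩
    · by_cases hi : θ i = 0
      · exact (hzero n i hi).symm ▸ (hzs n).1 i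
      · exact (hn i hi).le
    · simp [Finset.sum_add_distrib, Finset.sum_sub_distrib, hθ.2, hz.2, (hzs n).2]
  refine ⟨fun n => if θ + zs n - z ∈ stdSimplex ℝ (Fin d) then θ + zs n - z else θ,
    fun n => ?_, ?_, ?_⟩
  · beta_reduce
    split_ifs with h
    exacts [h, hθ]
  · refine hshift.congr' ?_
    filter_upwards [hmem] with n hn
    rw [if_pos hn]
  · have hsum : Tendsto (fun n => ∑ i, zs n i * Real.log (zs n i / (θ + zs n - z) i)) atTop
        (𝓝 (∑ i, z i * Real.log (z i / θ i))) := by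
      refine tendsto_finsetSum _ fun i _ => ?_
      by_cases hi : θ i = 0
      · have hterm : ∀ n, zs n i * Real.log (zs n i / (θ + zs n - z) i) = 0 := fun n => by
          rw [hzero n i hi]
          by_cases h : zs n i = 0 <;> simp [h]
        simp only [hterm, hac i hi, zero_mul, tendsto_const_nhds]
      · exact tendsto_mul_log_div (hz_i i) (tendsto_pi_nhds.1 hshift i) hi
    rw [relEnt, if_pos hac]
    refine (ENNReal.tendsto_ofReal hsum).congr' ?_
    filter_upwards [hmem, hpos] with n hn hn'
    rw [if_pos hn, relEnt, if_pos]
    intro i h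
    by_cases hi : θ i = 0
    · rwa [hzero n i hi] at h
    · exact absurd h (hn' i hi).ne'

end
end
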